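/- arXiv:1509.02023 — 2 statements merged into one kernel-verified Lean document; each statement's English description precedes it below -/
import Mathlib

section
/- Let 𝔏 be an M-player λ_p-Lipschitz game in which each strategy space S_i is the convex hull of n vectors each of L_p norm at most γ, let x = (x_1, …, x_M) be any strategy profile, fix a player i, and let x̂_i ∈ S_i be a best response of player i against x_{−i}, i.e. a maximizer of T_i(·, x_{−i}) over S_i. Then for every ε > 0 and every positive integer k ≥ 4λ²pγ²/ε², there exists a k-uniform strategy x'_i ∈ S_i such that T_i(x̂_i, x_{−i}) − T_i(x'_i, x_{−i}) ≤ ε. -/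
open Finset

/-- The `L_p` norm of a vector in `ℝ^d` (for a real exponent `p`). -/
noncomputable def lpNorm {d : ℕ} (p : ℝ) (x : Fin d → ℝ) : ℝ :=
  (∑ i, |x i| ^ p) ^ (1 / p)

/-- The `L_p` norm of a strategy profile, viewed as the concatenated vector in `ℝ^{Md}`. -/
noncomputable def lpNormProd {M d : ℕ} (p : ℝ) (x : Fin M → Fin d → ℝ) : ℝ :=
  (∑ i, ∑ j, |x i j| ^ p) ^ (1 / p)

/-- The elementary form of `tanh (q u) ≤ q tanh u`. -/
lemma one_add_rpow_sub_one_sub_rpow_le {q b : ℝ} (hq : 1 ≤ q) (hb0 : 0 ≤ b) (hb1 : b ≤ 1) :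
    (1 + b) ^ q - (1 - b) ^ q ≤ q * b * ((1 + b) ^ q + (1 - b) ^ q) := by
  let f : ℝ → ℝ := fun t ↦ q * t * ((1 + t) ^ q + (1 - t) ^ q) - ((1 + t) ^ q - (1 - t) ^ q)
  have hderiv : ∀ t ∈ Set.Ioo (0 : ℝ) 1, HasDerivAt f
      (q * (q + 1) * t * ((1 + t) ^ (q - 1) - (1 - t) ^ (q - 1))) t := by
    rintro t ⟨ht0, ht1⟩
    have hA : HasDerivAt (fun t : ℝ ↦ (1 + t) ^ q) (1 * q * (1 + t) ^ (q - 1)) t :=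
      ((hasDerivAt_id t).const_add 1).rpow_const (Or.inr hq)
    have hB : HasDerivAt (fun t : ℝ ↦ (1 - t) ^ q) (-1 * q * (1 - t) ^ (q - 1)) t :=
      ((hasDerivAt_id t).const_sub 1).rpow_const (Or.inr hq)
    have hqt : HasDerivAt (fun t : ℝ ↦ q * t) (q * 1) t := (hasDerivAt_id t).const_mul q
    refine ((hqt.mul (hA.add hB)).sub (hA.sub hB)).congr_deriv ?_
    have h1 : (1 + t) ^ q = (1 + t) * (1 + t) ^ (q - 1) := by
      rw [Real.rpow_sub_one (by linarith)]; field_simp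
    have h2 : (1 - t) ^ q = (1 - t) * (1 - t) ^ (q - 1) := by
      rw [Real.rpow_sub_one (by linarith)]
      have : 1 - t ≠ 0 := by linarith
      field_simp
    simp only [Pi.add_apply, h1, h2]
    ring
  have hq0 : 0 ≤ q := by linarith
  have hmono : MonotoneOn f (Set.Icc 0 1) := by
    refine monotoneOn_of_deriv_nonneg (convex_Icc 0 1) ?_ ?_ ?_
    · have h1 : Continuous fun t : ℝ ↦ (1 + t) ^ q :=
        (continuous_const.add continuous_id).rpow_const fun _ ↦ Or.inr hq0
      have h2 : Continuous fun t : ℝ ↦ (1 - t) ^ q :=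
        (continuous_const.sub continuous_id).rpow_const fun _ ↦ Or.inr hq0
      exact (((continuous_const.mul continuous_id).mul (h1.add h2)).sub (h1.sub h2)).continuousOn
    · rw [interior_Icc]
      exact fun t ht ↦ (hderiv t ht).differentiableAt.differentiableWithinAt
    · rw [interior_Icc]
      intro t ht
      rw [(hderiv t ht).deriv]
      have : (1 - t) ^ (q - 1) ≤ (1 + t) ^ (q - 1) :=
        Real.rpow_le_rpow (by linarith [ht.2]) (by linarith [ht.1]) (by linarith)
      have := ht.1
      exact mul_nonneg (by positivity) (by linarith)
  have := hmono (Set.left_mem_Icc.2 zero_le_one) ⟨hb0, hb1⟩ hb0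
  simp only [f] at this
  norm_num at this
  linarith

/-- The two-point hypercontractive inequality, normalized. -/
lemma one_add_rpow_add_one_sub_rpow_le {p b : ℝ} (hp : 2 ≤ p) (hb0 : 0 ≤ b) (hb1 : b ≤ 1) :
    (1 + b) ^ p + (1 - b) ^ p ≤ 2 * (1 + (p - 1) * b ^ 2) ^ (p / 2) := by
  have hp1 : 1 ≤ p := by linarith
  have hp0 : 0 ≤ p := by linarith
  have hpos : ∀ t : ℝ, 0 < 1 + (p - 1) * t ^ 2 := fun t ↦ by
    have := mul_nonneg (sub_nonneg.2 hp1) (sq_nonneg t)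
    linarith
  let f : ℝ → ℝ := fun t ↦ ((1 + t) ^ p + (1 - t) ^ p) * (1 + (p - 1) * t ^ 2) ^ (-(p / 2))
  have hderiv : ∀ t ∈ Set.Ioo (0 : ℝ) 1, HasDerivAt f
      (p * (1 + (p - 1) * t ^ 2) ^ (-(p / 2) - 1) *
        (((1 + t) ^ (p - 1) - (1 - t) ^ (p - 1)) -
          (p - 1) * t * ((1 + t) ^ (p - 1) + (1 - t) ^ (p - 1)))) t := by
    rintro t ⟨ht0, ht1⟩
    have hA : HasDerivAt (fun t : ℝ ↦ (1 + t) ^ p) (1 * p * (1 + t) ^ (p - 1)) t :=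
      ((hasDerivAt_id t).const_add 1).rpow_const (Or.inr hp1)
    have hB : HasDerivAt (fun t : ℝ ↦ (1 - t) ^ p) (-1 * p * (1 - t) ^ (p - 1)) t :=
      ((hasDerivAt_id t).const_sub 1).rpow_const (Or.inr hp1)
    have hD : HasDerivAt (fun t : ℝ ↦ 1 + (p - 1) * t ^ 2) ((p - 1) * (2 * t)) t := by
      simpa using ((hasDerivAt_pow 2 t).const_mul (p - 1)).const_add 1
    have hE := hD.rpow_const (p := -(p / 2)) (Or.inl (hpos t).ne')
    refine ((hA.add hB).mul hE).congr_deriv ?_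
    have h1 : (1 + t) ^ p = (1 + t) * (1 + t) ^ (p - 1) := by
      rw [Real.rpow_sub_one (by linarith)]; field_simp
    have h2 : (1 - t) ^ p = (1 - t) * (1 - t) ^ (p - 1) := by
      rw [Real.rpow_sub_one (by linarith)]
      have : 1 - t ≠ 0 := by linarith
      field_simp
    have h3 : (1 + (p - 1) * t ^ 2) ^ (-(p / 2)) =
        (1 + (p - 1) * t ^ 2) * (1 + (p - 1) * t ^ 2) ^ (-(p / 2) - 1) := by
      rw [Real.rpow_sub_one (hpos t).ne']
      have := (hpos t).ne'
      field_simp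
    simp only [Pi.add_apply, h1, h2, h3]
    ring
  have hanti : AntitoneOn f (Set.Icc 0 1) := by
    refine antitoneOn_of_deriv_nonpos (convex_Icc 0 1) ?_ ?_ ?_
    · have h1 : Continuous fun t : ℝ ↦ (1 + t) ^ p :=
        (continuous_const.add continuous_id).rpow_const fun _ ↦ Or.inr hp0
      have h2 : Continuous fun t : ℝ ↦ (1 - t) ^ p :=
        (continuous_const.sub continuous_id).rpow_const fun _ ↦ Or.inr hp0
      have h3 : Continuous fun t : ℝ ↦ (1 + (p - 1) * t ^ 2) ^ (-(p / 2)) :=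
        Continuous.rpow_const (by fun_prop) fun t ↦ Or.inl (hpos t).ne'
      exact ((h1.add h2).mul h3).continuousOn
    · rw [interior_Icc]
      exact fun t ht ↦ (hderiv t ht).differentiableAt.differentiableWithinAt
    · rw [interior_Icc]
      intro t ht
      rw [(hderiv t ht).deriv]
      have := one_add_rpow_sub_one_sub_rpow_le (q := p - 1) (by linarith) ht.1.le ht.2.le
      have := (hpos t).le
      exact mul_nonpos_of_nonneg_of_nonpos (by positivity) (by linarith)
  have := hanti (Set.left_mem_Icc.2 zero_le_one) ⟨hb0, hb1⟩ hb0
  simp only [f] at this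
  rw [Real.rpow_neg (hpos b).le, ← div_eq_mul_inv,
    div_le_iff₀ (Real.rpow_pos_of_pos (hpos b) _)] at this
  norm_num at this
  linarith

lemma add_rpow_add_sub_rpow_le {p a b : ℝ} (hp : 2 ≤ p) (hb : 0 ≤ b) (hab : b ≤ a) :
    (a + b) ^ p + (a - b) ^ p ≤ 2 * (a ^ 2 + (p - 1) * b ^ 2) ^ (p / 2) := by
  rcases (hb.trans hab).eq_or_lt with rfl | ha
  · obtain rfl : b = 0 := le_antisymm hab hb
    have h1 : p ≠ 0 := by linarith
    simp [Real.zero_rpow h1]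
    positivity
  have h := one_add_rpow_add_one_sub_rpow_le hp (div_nonneg hb ha.le) ((div_le_one ha).2 hab)
  have hc : 0 ≤ 1 - b / a := sub_nonneg.2 ((div_le_one ha).2 hab)
  have hD : 0 ≤ 1 + (p - 1) * (b / a) ^ 2 := by
    have := mul_nonneg (show 0 ≤ p - 1 by linarith) (sq_nonneg (b / a))
    linarith
  have h1 : (a + b) ^ p = a ^ p * (1 + b / a) ^ p := by
    rw [← Real.mul_rpow ha.le (by positivity)]; congr 1; field_simp
  have h2 : (a - b) ^ p = a ^ p * (1 - b / a) ^ p := by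
    rw [← Real.mul_rpow ha.le hc]; congr 1; field_simp
  have h3 : (a ^ 2 + (p - 1) * b ^ 2) ^ (p / 2) =
      a ^ p * (1 + (p - 1) * (b / a) ^ 2) ^ (p / 2) := by
    have : a ^ p = (a ^ 2) ^ (p / 2) := by
      rw [← Real.rpow_natCast_mul ha.le]; congr 1; push_cast; ring
    rw [this, ← Real.mul_rpow (by positivity) hD]; congr 1; field_simp
  rw [h1, h2, h3]
  nlinarith [mul_le_mul_of_nonneg_left h (Real.rpow_nonneg ha.le p)]

/-- The two-point hypercontractive inequality. -/
lemma abs_add_rpow_add_abs_sub_rpow_le {p : ℝ} (hp : 2 ≤ p) (a b : ℝ) :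
    |a + b| ^ p + |a - b| ^ p ≤ 2 * (a ^ 2 + (p - 1) * b ^ 2) ^ (p / 2) := by
  have key : |a + b| ^ p + |a - b| ^ p = (|a| + |b|) ^ p + |(|a| - |b|)| ^ p := by
    rcases le_total 0 a with ha | ha <;> rcases le_total 0 b with hb | hb
    · rw [abs_of_nonneg ha, abs_of_nonneg hb, abs_of_nonneg (add_nonneg ha hb)]
    · rw [abs_of_nonneg ha, abs_of_nonpos hb, abs_of_nonneg (show 0 ≤ a - b by linarith),
        sub_neg_eq_add, ← sub_eq_add_neg, add_comm]
    · rw [abs_of_nonpos ha, abs_of_nonneg hb, abs_of_nonpos (show a - b ≤ 0 by linarith),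
        ← abs_neg (a + b), add_comm]
      congr 2 <;> ring_nf
    · rw [abs_of_nonpos ha, abs_of_nonpos hb, abs_of_nonpos (add_nonpos ha hb),
        ← abs_neg (a - b)]
      congr 2 <;> ring_nf
  rw [key, ← sq_abs a, ← sq_abs b]
  rcases le_total |b| |a| with h | h
  · rw [abs_of_nonneg (sub_nonneg.2 h)]
    exact add_rpow_add_sub_rpow_le hp (abs_nonneg b) h
  · rw [abs_sub_comm, abs_of_nonneg (sub_nonneg.2 h), add_comm |a|]
    refine (add_rpow_add_sub_rpow_le hp (abs_nonneg a) h).trans ?_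
    have hsq : |a| ^ 2 ≤ |b| ^ 2 := by gcongr
    have hp2 : 0 ≤ (p - 2) * (|b| ^ 2 - |a| ^ 2) := mul_nonneg (by linarith) (by linarith)
    have hp1 : 0 ≤ p - 1 := by linarith
    gcongr 2 * ?_ ^ (p / 2)
    linarith

/-- `ℓ^p` is 2-uniformly smooth with constant `p - 1` for `2 ≤ p`. -/
lemma PiLp.norm_add_sq_add_norm_sub_sq_le {ι : Type*} [Fintype ι] {p : ℝ} (hp : 2 ≤ p)
    [Fact (1 ≤ ENNReal.ofReal p)] (s y : PiLp (ENNReal.ofReal p) fun _ : ι ↦ ℝ) :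
    ‖s + y‖ ^ 2 + ‖s - y‖ ^ 2 ≤ 2 * ‖s‖ ^ 2 + 2 * (p - 1) * ‖y‖ ^ 2 := by
  have hp0 : 0 < p := by linarith
  have hp1 : 0 ≤ p - 1 := by linarith
  have hpr : (ENNReal.ofReal p).toReal = p := ENNReal.toReal_ofReal hp0.le
  have hnorm : ∀ z : PiLp (ENNReal.ofReal p) fun _ : ι ↦ ℝ, ‖z‖ = (∑ i, |z i| ^ p) ^ (1 / p) := by
    intro z
    rw [PiLp.norm_eq_sum (by rw [hpr]; exact hp0), hpr]
    simp
  have hsum : ∀ z : PiLp (ENNReal.ofReal p) fun _ : ι ↦ ℝ, 0 ≤ ∑ i, |z i| ^ p := fun z ↦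
    Finset.sum_nonneg fun i _ ↦ by positivity
  have hpow : ∀ z : PiLp (ENNReal.ofReal p) fun _ : ι ↦ ℝ,
      (‖z‖ ^ 2) ^ (p / 2) = ∑ i, |z i| ^ p := by
    intro z
    rw [← Real.rpow_natCast_mul (norm_nonneg z), hnorm, ← Real.rpow_mul (hsum z)]
    convert Real.rpow_one _ using 2
    push_cast; field_simp
  have hsqr : ∀ z : PiLp (ENNReal.ofReal p) fun _ : ι ↦ ℝ,
      (∑ i, |z i| ^ p) ^ (1 / (p / 2)) = ‖z‖ ^ 2 := by
    intro z
    rw [← hpow, ← Real.rpow_mul (by positivity)]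
    convert Real.rpow_one _ using 2
    field_simp
  have habs : ∀ t : ℝ, (t ^ 2) ^ (p / 2) = |t| ^ p := by
    intro t
    rw [← sq_abs, ← Real.rpow_natCast_mul (abs_nonneg t)]
    congr 1; push_cast; ring
  have hmink := Real.Lp_add_le Finset.univ (fun i ↦ s i ^ 2) (fun i ↦ (p - 1) * y i ^ 2)
    (p := p / 2) (by linarith)
  have hs : ∑ i, |s i ^ 2| ^ (p / 2) = ∑ i, |s i| ^ p :=
    Finset.sum_congr rfl fun i _ ↦ by rw [abs_of_nonneg (sq_nonneg _), habs]
  have hy : ∑ i, |(p - 1) * y i ^ 2| ^ (p / 2) = (p - 1) ^ (p / 2) * ∑ i, |y i| ^ p := by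
    rw [Finset.mul_sum]
    exact Finset.sum_congr rfl fun i _ ↦ by
      rw [abs_of_nonneg (by positivity), Real.mul_rpow hp1 (sq_nonneg _), habs]
  have hD : ∀ i, 0 ≤ s i ^ 2 + (p - 1) * y i ^ 2 := fun i ↦ by positivity
  have hD' : 0 ≤ ∑ i, (s i ^ 2 + (p - 1) * y i ^ 2) ^ (p / 2) :=
    Finset.sum_nonneg fun i _ ↦ Real.rpow_nonneg (hD i) _
  rw [hs, hy, Real.mul_rpow (by positivity) (hsum y), hsqr, hsqr, ← Real.rpow_mul hp1,
    mul_one_div_cancel (by positivity), Real.rpow_one] at hmink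
  simp only [abs_of_nonneg (hD _)] at hmink
  have hpt : ∑ i, |(s + y) i| ^ p + ∑ i, |(s - y) i| ^ p ≤
      2 * ∑ i, (s i ^ 2 + (p - 1) * y i ^ 2) ^ (p / 2) := by
    rw [← Finset.sum_add_distrib, Finset.mul_sum]
    exact Finset.sum_le_sum fun i _ ↦ abs_add_rpow_add_abs_sub_rpow_le hp (s i) (y i)
  have hjensen := (convexOn_rpow (p := p / 2) (by linarith)).2
    (Set.mem_Ici.2 (sq_nonneg ‖s + y‖)) (Set.mem_Ici.2 (sq_nonneg ‖s - y‖))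
    (by norm_num : (0 : ℝ) ≤ 1 / 2) (by norm_num : (0 : ℝ) ≤ 1 / 2) (by norm_num)
  simp only [smul_eq_mul] at hjensen
  rw [hpow, hpow] at hjensen
  have hmean : 1 / 2 * ‖s + y‖ ^ 2 + 1 / 2 * ‖s - y‖ ^ 2 ≤
      (∑ i, (s i ^ 2 + (p - 1) * y i ^ 2) ^ (p / 2)) ^ (1 / (p / 2)) := by
    rw [one_div (p / 2), Real.le_rpow_inv_iff_of_pos (by positivity) hD' (by positivity)]
    linarith
  linarith

section Smooth

variable {E : Type*} [NormedAddCommGroup E] [NormedSpace ℝ E]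

/-- A two-point smoothness inequality for the norm yields a one-sided quadratic upper bound
by a continuous linear functional with the same constant. -/
lemma exists_norm_add_sq_le_of_two_point {C : ℝ}
    (hC : ∀ s y : E, ‖s + y‖ ^ 2 + ‖s - y‖ ^ 2 ≤ 2 * ‖s‖ ^ 2 + 2 * C * ‖y‖ ^ 2) (s : E) :
    ∃ L : E →L[ℝ] ℝ, ∀ y, ‖s + y‖ ^ 2 ≤ ‖s‖ ^ 2 + L y + C * ‖y‖ ^ 2 := by
  obtain ⟨g, hg1, hgs⟩ := exists_dual_vector'' ℝ s
  have hgs : g s = ‖s‖ := by simpa using hgs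
  have hlow : ∀ y, ‖s‖ ^ 2 + 2 * ‖s‖ * g y ≤ ‖s + y‖ ^ 2 := by
    intro y
    have h1 : |g (s + y)| ≤ ‖s + y‖ := by
      have := g.le_of_opNorm_le hg1 (s + y)
      simpa using this
    have h2 : g (s + y) ^ 2 ≤ ‖s + y‖ ^ 2 := sq_le_sq' (abs_le.1 h1).1 (abs_le.1 h1).2
    rw [map_add, hgs] at h2
    nlinarith [sq_nonneg (g y)]
  have hiter : ∀ m : ℕ, ∀ y,
      ‖s + y‖ ^ 2 ≤ ‖s‖ ^ 2 + 2 * ‖s‖ * g y + C * (1 + (1 / 2) ^ m) * ‖y‖ ^ 2 := by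
    intro m
    induction m with
    | zero =>
      intro y
      have h1 := hlow (-y)
      rw [map_neg, ← sub_eq_add_neg] at h1
      have h2 := hC s y
      norm_num
      linarith
    | succ m ih =>
      intro y
      have h1 := ih ((1 / 2 : ℝ) • y)
      have h2 := hC (s + (1 / 2 : ℝ) • y) ((1 / 2 : ℝ) • y)
      have h3 : s + (1 / 2 : ℝ) • y + (1 / 2 : ℝ) • y = s + y := by module
      rw [h3, add_sub_cancel_right] at h2
      rw [norm_smul, map_smul, smul_eq_mul] at h1
      rw [norm_smul] at h2
      norm_num at h1 h2
      rw [pow_succ (1 / 2 : ℝ) m]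
      linarith
  refine ⟨(2 * ‖s‖) • g, fun y ↦ ?_⟩
  have hlim : Filter.Tendsto
      (fun m : ℕ ↦ ‖s‖ ^ 2 + 2 * ‖s‖ * g y + C * (1 + (1 / 2 : ℝ) ^ m) * ‖y‖ ^ 2) Filter.atTop
      (nhds (‖s‖ ^ 2 + 2 * ‖s‖ * g y + C * (1 + 0) * ‖y‖ ^ 2)) :=
    tendsto_const_nhds.add (((tendsto_const_nhds.add
      (tendsto_pow_atTop_nhds_zero_of_lt_one (by norm_num) (by norm_num))).const_mul C).mul_const _)
  have := ge_of_tendsto' hlim fun m ↦ hiter m y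
  simpa using this

/-- The approximate Carathéodory theorem in a 2-uniformly smooth space. -/
lemma exists_norm_sum_sub_sq_le_of_two_point {ι : Type*} {C R : ℝ} (hC0 : 0 ≤ C)
    (hC : ∀ s y : E, ‖s + y‖ ^ 2 + ‖s - y‖ ^ 2 ≤ 2 * ‖s‖ ^ 2 + 2 * C * ‖y‖ ^ 2)
    {Y : ι → E} {x : E} (hx : x ∈ convexHull ℝ (Set.range Y)) (hR : ∀ j, ‖Y j - x‖ ≤ R) (k : ℕ) :
    ∃ v : Fin k → ι, ‖∑ t, (Y (v t) - x)‖ ^ 2 ≤ k * (C * R ^ 2) := by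
  induction k with
  | zero => exact ⟨Fin.elim0, by simp⟩
  | succ k ih =>
    obtain ⟨v, hv⟩ := ih
    obtain ⟨L, hL⟩ := exists_norm_add_sq_le_of_two_point hC (∑ t, (Y (v t) - x))
    obtain ⟨j, hj⟩ : ∃ j, L (Y j) ≤ L x := by
      by_contra! h
      have : convexHull ℝ (Set.range Y) ⊆ {z | L x < L z} :=
        convexHull_min (by rintro _ ⟨j, rfl⟩; exact h j)
          (convex_halfSpace_gt L.toLinearMap.isLinear _)
      exact (lt_irrefl (L x)) (this hx)
    refine ⟨Fin.snoc v j, ?_⟩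
    simp only [Fin.sum_univ_castSucc, Fin.snoc_castSucc, Fin.snoc_last]
    have h1 := hL (Y j - x)
    rw [map_sub] at h1
    have h2 : C * ‖Y j - x‖ ^ 2 ≤ C * R ^ 2 := by gcongr; exact hR j
    push_cast
    linarith

end Smooth

/-- The approximate Carathéodory theorem for the `L_p` norm, `2 ≤ p`. -/
lemma exists_mul_lpNorm_sub_sq_le {ι : Type*} {d : ℕ} {p γ : ℝ} (hp : 2 ≤ p)
    {Y : ι → Fin d → ℝ} (hγ : ∀ j, lpNorm p (Y j) ≤ γ) {x : Fin d → ℝ}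
    (hx : x ∈ convexHull ℝ (Set.range Y)) {k : ℕ} (hk : 0 < k) :
    ∃ v : Fin k → ι, k * lpNorm p (x - (k : ℝ)⁻¹ • ∑ t, Y (v t)) ^ 2 ≤ 4 * p * γ ^ 2 := by
  have hp0 : 0 < p := by linarith
  have : Fact (1 ≤ ENNReal.ofReal p) := ⟨by
    rw [← ENNReal.ofReal_one]; exact ENNReal.ofReal_le_ofReal (by linarith)⟩
  have hpr : (ENNReal.ofReal p).toReal = p := ENNReal.toReal_ofReal hp0.le
  obtain ⟨e, hnorm⟩ : ∃ e : (Fin d → ℝ) →ₗ[ℝ] PiLp (ENNReal.ofReal p) fun _ : Fin d ↦ ℝ,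
      ∀ z, ‖e z‖ = lpNorm p z := by
    refine ⟨(WithLp.linearEquiv (ENNReal.ofReal p) ℝ (Fin d → ℝ)).symm.toLinearMap, fun z ↦ ?_⟩
    rw [PiLp.norm_eq_sum (by rw [hpr]; exact hp0), hpr]
    rfl
  have hex : e x ∈ convexHull ℝ (Set.range fun j ↦ e (Y j)) := by
    have h := Set.mem_image_of_mem e hx
    rw [e.image_convexHull, ← Set.range_comp] at h
    exact h
  have hxnorm : ‖e x‖ ≤ γ := by
    have : convexHull ℝ (Set.range fun j ↦ e (Y j)) ⊆ Metric.closedBall 0 γ :=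
      convexHull_min (by rintro _ ⟨j, rfl⟩; simpa [hnorm] using hγ j) (convex_closedBall _ _)
    simpa using this hex
  have hR : ∀ j, ‖e (Y j) - e x‖ ≤ 2 * γ := fun j ↦ by
    have h1 := norm_sub_le (e (Y j)) (e x)
    have h2 := hγ j
    rw [← hnorm] at h2
    linarith
  have hp1 : 0 ≤ p - 1 := by linarith
  obtain ⟨v, hv⟩ := exists_norm_sum_sub_sq_le_of_two_point
    (E := PiLp (ENNReal.ofReal p) fun _ : Fin d ↦ ℝ) hp1
    (fun s y ↦ PiLp.norm_add_sq_add_norm_sub_sq_le hp s y) hex hR k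
  refine ⟨v, ?_⟩
  have hk0 : (0 : ℝ) < k := by exact_mod_cast hk
  rw [← hnorm]
  set w : Fin d → ℝ := (k : ℝ)⁻¹ • ∑ t, Y (v t) with hw
  have hdiff : (k : ℝ) * ‖e (x - w)‖ = ‖∑ t, (e (Y (v t)) - e x)‖ := by
    have h1 : (k : ℝ) • e (x - w) = -∑ t, (e (Y (v t)) - e x) := by
      rw [Finset.sum_sub_distrib, ← map_sum, map_sub, hw, map_smul, smul_sub, smul_smul,
        mul_inv_cancel₀ hk0.ne', one_smul]
      simp [Nat.cast_smul_eq_nsmul]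
    rw [← norm_neg (∑ t, _), ← h1, norm_smul, Real.norm_natCast]
  rw [← hdiff] at hv
  have : (k : ℝ) * (k * ‖e (x - w)‖ ^ 2) ≤ k * (4 * p * γ ^ 2) := by
    have := mul_nonneg hk0.le (sq_nonneg γ)
    linarith
  exact le_of_mul_le_mul_left this hk0

/-- in a `λ_p`-Lipschitz game there is a `k`-uniform `ε`-best response
for every `k ≥ 4λ²pγ²/ε²`. -/
theorem lipschitz_game_kUniform_approx_best_response
    {M n d : ℕ} (p lam γ : ℝ) (hp : 2 ≤ p) (hlam : 0 < lam)
    (Y : Fin M → Fin n → Fin d → ℝ)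
    (S : Fin M → Set (Fin d → ℝ))
    (hS : ∀ i, S i = convexHull ℝ (Set.range (Y i)))
    (hγ : ∀ i j, lpNorm p (Y i j) ≤ γ)
    (T : Fin M → (Fin M → Fin d → ℝ) → ℝ)
    (hT : ∀ i, ∀ x y : Fin M → Fin d → ℝ, (∀ j, x j ∈ S j) → (∀ j, y j ∈ S j) →
      |T i x - T i y| ≤ lam * lpNormProd p (x - y))
    (x : Fin M → Fin d → ℝ) (hxS : ∀ j, x j ∈ S j)
    (i : Fin M) (xhat : Fin d → ℝ) (hxhat : xhat ∈ S i)
    (hbest : ∀ z ∈ S i, T i (Function.update x i z) ≤ T i (Function.update x i xhat))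
    (ε : ℝ) (hε : 0 < ε) (k : ℕ) (hk : 0 < k)
    (hkbig : 4 * lam ^ 2 * p * γ ^ 2 / ε ^ 2 ≤ k) :
    ∃ v : Fin k → Fin n,
      T i (Function.update x i xhat)
        - T i (Function.update x i ((k : ℝ)⁻¹ • ∑ t, Y i (v t))) ≤ ε := by
  have hp0 : 0 < p := by linarith
  obtain ⟨v, hN⟩ := exists_mul_lpNorm_sub_sq_le hp (hγ i) (hS i ▸ hxhat) hk
  refine ⟨v, ?_⟩
  have hmem : ∀ j, Y i j ∈ S i := fun j ↦ by
    rw [hS]; exact subset_convexHull ℝ _ ⟨j, rfl⟩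
  have hconv : Convex ℝ (S i) := by rw [hS]; exact convex_convexHull ℝ _
  set w : Fin d → ℝ := (k : ℝ)⁻¹ • ∑ t, Y i (v t) with hw
  have hk0 : (0 : ℝ) < k := by exact_mod_cast hk
  have hwS : w ∈ S i := by
    rw [hw, Finset.smul_sum]
    exact hconv.sum_mem (fun _ _ ↦ by positivity) (by simp [hk0.ne']) fun t _ ↦ hmem (v t)
  have hupd : ∀ z ∈ S i, ∀ j, Function.update x i z j ∈ S j := by
    intro z hz j
    rcases eq_or_ne j i with rfl | hj
    · simpa using hz
    · simpa [hj] using hxS j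
  have hprod : lpNormProd p (Function.update x i xhat - Function.update x i w) =
      lpNorm p (xhat - w) := by
    unfold lpNormProd lpNorm
    congr 1
    rw [Finset.sum_eq_single i]
    · simp
    · intro j _ hj
      simp [hj, Real.zero_rpow hp0.ne']
    · simp
  have hLip := hT i _ _ (hupd xhat hxhat) (hupd w hwS)
  rw [hprod] at hLip
  rw [div_le_iff₀ (by positivity)] at hkbig
  have hsq : (lam * lpNorm p (xhat - w)) ^ 2 ≤ ε ^ 2 := by
    have h1 := mul_le_mul_of_nonneg_left hN (sq_nonneg lam)
    refine le_of_mul_le_mul_left ?_ hk0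
    linarith
  exact (le_abs_self _).trans (hLip.trans (le_of_sq_le_sq hsq hε.le))
end

section
/- Consider an L₁-biased game with utilities T_r(x, y) = xᵀRy − d_r·‖x − p‖₁ and T_c(x, y) = xᵀCy − d_c·‖y − q‖₁, where R, C have entries in [0,1] and 0 ≤ d_r, d_c ≤ 1/2. Let y* ∈ Δⁿ be a best response of the column player against p (a maximizer of T_c(p, ·)), let x ∈ Δⁿ be a best response of the row player against y* (a maximizer of T_r(·, y*)), and let x* = (2/3)·p + (1/3)·x. Then (x*, y*) is a 2/3-equilibrium: T_r(x̃, y*) ≤ T_r(x*, y*) + 2/3 for every x̃ ∈ Δⁿ, and T_c(x*, ỹ) ≤ T_c(x*, y*) + 2/3 for every ỹ ∈ Δⁿ. -/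
open Finset Matrix

/-- Row player's utility in an `L₁`-biased game: `xᵀRy − d_r·‖x − p‖₁`. -/
noncomputable def TrL1 {n : ℕ} (R : Matrix (Fin n) (Fin n) ℝ) (dr : ℝ) (p : Fin n → ℝ)
    (x y : Fin n → ℝ) : ℝ := x ⬝ᵥ R.mulVec y - dr * ∑ i, |x i - p i|

/-- Column player's utility in an `L₁`-biased game: `xᵀCy − d_c·‖y − q‖₁`. -/
noncomputable def TcL1 {n : ℕ} (C : Matrix (Fin n) (Fin n) ℝ) (dc : ℝ) (q : Fin n → ℝ)
    (x y : Fin n → ℝ) : ℝ := x ⬝ᵥ C.mulVec y - dc * ∑ i, |y i - q i|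

/-- A bilinear form with entries in `[0, 1]` takes values in `[0, 1]` on pairs of probability
vectors. -/
theorem dotProduct_mulVec_mem_Icc {n : ℕ} {A : Matrix (Fin n) (Fin n) ℝ}
    (hA : ∀ i j, A i j ∈ Set.Icc (0 : ℝ) 1) {x y : Fin n → ℝ}
    (hx : x ∈ stdSimplex ℝ (Fin n)) (hy : y ∈ stdSimplex ℝ (Fin n)) :
    x ⬝ᵥ A.mulVec y ∈ Set.Icc (0 : ℝ) 1 := by
  have h0 : ∀ i, 0 ≤ A.mulVec y i := fun i => by
    simp only [mulVec, dotProduct]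
    exact Finset.sum_nonneg fun j _ => mul_nonneg (hA i j).1 (hy.1 j)
  have h1 : ∀ i, A.mulVec y i ≤ 1 := fun i => by
    rw [← hy.2]
    simp only [mulVec, dotProduct]
    exact Finset.sum_le_sum fun j _ => mul_le_of_le_one_left (hy.1 j) (hA i j).2
  refine ⟨Finset.sum_nonneg fun i _ => mul_nonneg (hx.1 i) (h0 i), ?_⟩
  rw [← hx.2]
  exact Finset.sum_le_sum fun i _ => mul_le_of_le_one_right (hx.1 i) (h1 i)

/-- The `L₁` distance between two probability vectors is at most `2`. -/
theorem sum_abs_sub_le_two_of_mem_stdSimplex {n : ℕ} {x y : Fin n → ℝ}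
    (hx : x ∈ stdSimplex ℝ (Fin n)) (hy : y ∈ stdSimplex ℝ (Fin n)) :
    ∑ i, |x i - y i| ≤ 2 := by
  calc ∑ i, |x i - y i| ≤ ∑ i, (x i + y i) := Finset.sum_le_sum fun i _ => by
        rw [abs_le]
        constructor <;> linarith [hx.1 i, hy.1 i]
    _ = 2 := by rw [Finset.sum_add_distrib, hx.2, hy.2]; norm_num

/-- The row player's utility is affine on rays from the base strategy. -/
theorem TrL1_mix {n : ℕ} (R : Matrix (Fin n) (Fin n) ℝ) (dr : ℝ) (p x y : Fin n → ℝ)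
    {a b : ℝ} (hb : 0 ≤ b) (hab : a + b = 1) :
    TrL1 R dr p (a • p + b • x) y = a * TrL1 R dr p p y + b * TrL1 R dr p x y := by
  have h : ∑ i, |(a • p + b • x) i - p i| = b * ∑ i, |x i - p i| := by
    rw [Finset.mul_sum]
    refine Finset.sum_congr rfl fun i _ => ?_
    rw [← abs_of_nonneg hb, ← abs_mul, abs_of_nonneg hb]
    congr 1
    simp only [Pi.add_apply, Pi.smul_apply, smul_eq_mul]
    linear_combination p i * hab
  simp only [TrL1, h, add_dotProduct, smul_dotProduct, smul_eq_mul, sub_self, abs_zero,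
    Finset.sum_const_zero]
  ring

/-- The column player's utility is affine in the row player's strategy. -/
theorem TcL1_mix {n : ℕ} (C : Matrix (Fin n) (Fin n) ℝ) (dc : ℝ) (q x₁ x₂ y : Fin n → ℝ)
    {a b : ℝ} (hab : a + b = 1) :
    TcL1 C dc q (a • x₁ + b • x₂) y = a * TcL1 C dc q x₁ y + b * TcL1 C dc q x₂ y := by
  simp only [TcL1, add_dotProduct, smul_dotProduct, smul_eq_mul]
  linear_combination (dc * ∑ i, |y i - q i|) * hab

/-- the base algorithm gives a `2/3`-equilibrium in `L₁`-biased games with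
`d_r, d_c ≤ 1/2`: if `y*` is a best response against `p`, `x` a best response against `y*`,
and `x* = (2/3)·p + (1/3)·x`, then `(x*, y*)` is a `2/3`-equilibrium. -/
theorem L1_biased_two_thirds_equilibrium {n : ℕ}
    (R C : Matrix (Fin n) (Fin n) ℝ)
    (hR : ∀ i j, R i j ∈ Set.Icc (0 : ℝ) 1) (hC : ∀ i j, C i j ∈ Set.Icc (0 : ℝ) 1)
    (p q : Fin n → ℝ) (hp : p ∈ stdSimplex ℝ (Fin n)) (hq : q ∈ stdSimplex ℝ (Fin n))
    (dr dc : ℝ) (hdr0 : 0 ≤ dr) (hdr1 : dr ≤ 1 / 2) (hdc0 : 0 ≤ dc) (hdc1 : dc ≤ 1 / 2)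
    (ystar : Fin n → ℝ) (hystar : ystar ∈ stdSimplex ℝ (Fin n))
    (hbrc : ∀ y ∈ stdSimplex ℝ (Fin n), TcL1 C dc q p y ≤ TcL1 C dc q p ystar)
    (x : Fin n → ℝ) (hx : x ∈ stdSimplex ℝ (Fin n))
    (hbrr : ∀ z ∈ stdSimplex ℝ (Fin n), TrL1 R dr p z ystar ≤ TrL1 R dr p x ystar)
    (xstar : Fin n → ℝ) (hxstar : xstar = (2 / 3 : ℝ) • p + (1 / 3 : ℝ) • x) :
    (∀ xt ∈ stdSimplex ℝ (Fin n),
      TrL1 R dr p xt ystar ≤ TrL1 R dr p xstar ystar + 2 / 3) ∧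
    (∀ yt ∈ stdSimplex ℝ (Fin n),
      TcL1 C dc q xstar yt ≤ TcL1 C dc q xstar ystar + 2 / 3) := by
  subst hxstar
  refine ⟨fun xt hxt => ?_, fun yt hyt => ?_⟩
  · rw [TrL1_mix R dr p x ystar (by norm_num) (by norm_num)]
    have hbest := hbrr xt hxt
    have hx1 := (dotProduct_mulVec_mem_Icc hR hx hystar).2
    have hp0 := (dotProduct_mulVec_mem_Icc hR hp hystar).1
    have hpen : 0 ≤ dr * ∑ i, |x i - p i| :=
      mul_nonneg hdr0 (Finset.sum_nonneg fun i _ => abs_nonneg _)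
    have hTx : TrL1 R dr p x ystar ≤ 1 := by
      unfold TrL1
      linarith
    have hTp : 0 ≤ TrL1 R dr p p ystar := by
      simpa [TrL1] using hp0
    linarith
  · rw [TcL1_mix C dc q p x yt (by norm_num), TcL1_mix C dc q p x ystar (by norm_num)]
    have hbest := hbrc yt hyt
    have h1 := (dotProduct_mulVec_mem_Icc hC hx hyt).2
    have h0 := (dotProduct_mulVec_mem_Icc hC hx hystar).1
    have hpen : 0 ≤ dc * ∑ i, |yt i - q i| :=
      mul_nonneg hdc0 (Finset.sum_nonneg fun i _ => abs_nonneg _)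
    have hpen' : dc * ∑ i, |ystar i - q i| ≤ 1 := by
      have h2 := sum_abs_sub_le_two_of_mem_stdSimplex hystar hq
      have := mul_le_mul_of_nonneg_left h2 hdc0
      linarith
    have hdiff : TcL1 C dc q x yt ≤ TcL1 C dc q x ystar + 2 := by
      unfold TcL1
      linarith
    linarith
end
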